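/- For a one-sided topological Markov shift (X_A, σ_A), let Z(X_A, σ_A) be the set of dynamical zeta functions ζ_{A,g} of (X_A, σ_A) whose potential functions g ∈ C(X_A, ℤ) have class [g] an order unit of the ordered cohomology group (H^A, H^A_+). If (X_A, σ_A) and (X_B, σ_B) are one-sided flow equivalent, then Z(X_A, σ_A) = Z(X_B, σ_B). -/

import Mathlib

open scoped BigOperators NNReal

namespace OneSidedMarkov

variable {N M : ℕ}

/-- The matrix has entries in `{0, 1}`. -/
def IsZeroOne (A : Matrix (Fin N) (Fin N) ℤ) : Prop := ∀ i j, A i j = 0 ∨ A i j = 1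

/-- The matrix is irreducible. -/
def IsIrreducible (A : Matrix (Fin N) (Fin N) ℤ) : Prop :=
  ∀ i j, ∃ m : ℕ, 0 < m ∧ (A ^ m) i j ≠ 0

/-- The matrix is a permutation matrix. -/
def IsPermutationMatrix (A : Matrix (Fin N) (Fin N) ℤ) : Prop :=
  ∃ e : Equiv.Perm (Fin N), ∀ i j, A i j = if e i = j then 1 else 0

/-- The one-sided topological Markov shift space `X_A`. -/
abbrev Space (A : Matrix (Fin N) (Fin N) ℤ) : Type :=
  {x : ℕ → Fin N // ∀ n, A (x n) (x (n + 1)) = 1}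

/-- The shift map `σ_A`. -/
def shift (A : Matrix (Fin N) (Fin N) ℤ) (x : Space A) : Space A :=
  ⟨fun n => x.1 (n + 1), fun n => x.2 (n + 1)⟩

lemma continuous_shift (A : Matrix (Fin N) (Fin N) ℤ) : Continuous (shift A) := by
  apply Continuous.subtype_mk
  exact continuous_pi fun n => (continuous_apply (n + 1)).comp continuous_subtype_val

/-- The shift map as a continuous map. -/
def shiftMap (A : Matrix (Fin N) (Fin N) ℤ) : C(Space A, Space A) :=
  ⟨shift A, continuous_shift A⟩

/-- The coboundary subgroup `{ g - g ∘ σ_A }` of `C(X_A, ℤ)`. -/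
def cobdySubgroup (A : Matrix (Fin N) (Fin N) ℤ) : AddSubgroup C(Space A, ℤ) :=
  AddSubgroup.closure {f | ∃ g : C(Space A, ℤ), f = g - g.comp (shiftMap A)}

/-- The ordered cohomology group `H^A = C(X_A, ℤ)/{g - g∘σ_A}`. -/
abbrev Coh (A : Matrix (Fin N) (Fin N) ℤ) : Type :=
  C(Space A, ℤ) ⧸ cobdySubgroup A

/-- The class `[f] ∈ H^A`. -/
def cohClass (A : Matrix (Fin N) (Fin N) ℤ) (f : C(Space A, ℤ)) : Coh A :=
  QuotientAddGroup.mk f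

/-- The positive cone `H^A_+`. -/
def CohPos (A : Matrix (Fin N) (Fin N) ℤ) : Set (Coh A) :=
  {c | ∃ f : C(Space A, ℤ), (∀ x, 0 ≤ f x) ∧ c = cohClass A f}

/-- `u` is an order unit of `(H^A, H^A_+)`. -/
def IsOrderUnit (A : Matrix (Fin N) (Fin N) ℤ) (u : Coh A) : Prop :=
  u ∈ CohPos A ∧ ∀ g : Coh A, ∃ n : ℕ, 0 < n ∧ n • u - g ∈ CohPos A

/-- The data `(l, k, b)` of a suspension. -/
structure SuspData (A : Matrix (Fin N) (Fin N) ℤ) where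
  l : C(Space A, ℝ)
  k : C(Space A, ℝ)
  b : C(Space A, ℝ)

/-- `c = l - k`. -/
def cFun {A : Matrix (Fin N) (Fin N) ℤ} (T : SuspData A) (x : Space A) : ℝ :=
  T.l x - T.k x

/-- `(l, k, b)` is a suspension triplet for `(X_A, σ_A)`. -/
def IsSuspTriplet {A : Matrix (Fin N) (Fin N) ℤ} (T : SuspData A) : Prop :=
  (∀ x, 0 ≤ T.l x) ∧ (∀ x, 0 ≤ T.k x) ∧
  (∃ c : C(Space A, ℤ), (∀ x, (c x : ℝ) = cFun T x) ∧ IsOrderUnit A (cohClass A c)) ∧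
  (∀ x, ∃ m : ℕ, T.l x - T.b x = m) ∧
  (∀ x, ∃ m : ℕ, T.k x - T.b (shift A x) = m)

/-- The space `X_{A,b}^ℝ = {(x, r) : r ≥ b(x)}`. -/
abbrev BaseSpace {A : Matrix (Fin N) (Fin N) ℤ} (T : SuspData A) : Type :=
  {p : Space A × ℝ // T.b p.1 ≤ p.2}

/-- The elementary relation `(x, r) ∼ (σ_A(x), r - c(x))` for `r ≥ l(x)`. -/
def SuspRel {A : Matrix (Fin N) (Fin N) ℤ} (T : SuspData A)
    (p q : BaseSpace T) : Prop :=
  T.l p.1.1 ≤ p.1.2 ∧ q.1 = (shift A p.1.1, p.1.2 - cFun T p.1.1)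

/-- The equivalence relation `∼_{l,k}` generated by `SuspRel`. -/
def suspSetoid {A : Matrix (Fin N) (Fin N) ℤ} (T : SuspData A) : Setoid (BaseSpace T) :=
  ⟨Relation.EqvGen (SuspRel T), Relation.EqvGen.is_equivalence _⟩

/-- The one-sided suspension `S_{A,b}^{l,k}` with the quotient topology. -/
abbrev Susp {A : Matrix (Fin N) (Fin N) ℤ} (T : SuspData A) : Type :=
  Quotient (suspSetoid T)

/-- The class `[x, r]`. -/
def mkSusp {A : Matrix (Fin N) (Fin N) ℤ} (T : SuspData A) (p : BaseSpace T) : Susp T :=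
  Quotient.mk (suspSetoid T) p

/-- The base map `x ↦ [x, b(x)]`. -/
def basePoint {A : Matrix (Fin N) (Fin N) ℤ} (T : SuspData A) (x : Space A) : Susp T :=
  mkSusp T ⟨(x, T.b x), le_refl _⟩

/-- Translation by `t ≥ 0` on `X_{A,b}^ℝ`. -/
def shiftPt {A : Matrix (Fin N) (Fin N) ℤ} (T : SuspData A) (t : ℝ≥0)
    (p : BaseSpace T) : BaseSpace T :=
  ⟨(p.1.1, p.1.2 + t), le_trans p.2 (le_add_of_nonneg_right t.2)⟩

lemma suspRel_shiftPt {A : Matrix (Fin N) (Fin N) ℤ} (T : SuspData A) (t : ℝ≥0)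
    {p q : BaseSpace T} (h : SuspRel T p q) : SuspRel T (shiftPt T t p) (shiftPt T t q) := by
  obtain ⟨h1, h2⟩ := h
  refine ⟨le_trans h1 (le_add_of_nonneg_right t.2), ?_⟩
  show (q.1.1, q.1.2 + (t : ℝ)) = _
  rw [h2]
  show (shift A p.1.1, p.1.2 - cFun T p.1.1 + (t : ℝ))
      = (shift A p.1.1, p.1.2 + (t : ℝ) - cFun T p.1.1)
  congr 1
  ring

lemma eqvGen_map {α : Type*} {r r' : α → α → Prop} (f : α → α)
    (hf : ∀ a b, r a b → r' (f a) (f b)) :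
    ∀ a b, Relation.EqvGen r a b → Relation.EqvGen r' (f a) (f b) := by
  intro a b h
  induction h with
  | rel a b hab => exact Relation.EqvGen.rel _ _ (hf a b hab)
  | refl a => exact Relation.EqvGen.refl _
  | symm a b _ ih => exact Relation.EqvGen.symm _ _ ih
  | trans a b c _ _ ih1 ih2 => exact Relation.EqvGen.trans _ _ _ ih1 ih2

/-- The flow `φ_{A,t}([x, r]) = [x, r + t]`, `t ∈ ℝ_+`, on the one-sided suspension. -/
def flow {A : Matrix (Fin N) (Fin N) ℤ} (T : SuspData A) (t : ℝ≥0) :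
    Susp T → Susp T :=
  Quotient.map' (shiftPt T t)
    (fun p q h => eqvGen_map (shiftPt T t) (fun _ _ hr => suspRel_shiftPt T t hr) p q h)

/-- The standard suspension data `(1, 0, 0)`. -/
def stdData (A : Matrix (Fin N) (Fin N) ℤ) : SuspData A := ⟨1, 0, 0⟩

/-- The standard one-sided suspension `S_A^1`. -/
abbrev StdSusp (A : Matrix (Fin N) (Fin N) ℤ) : Type := Susp (stdData A)

/-- The standard base map `s_A(x) = [x, 0]`. -/
def stdBase (A : Matrix (Fin N) (Fin N) ℤ) : Space A → StdSusp A :=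
  basePoint (stdData A)

/-- The orbit equations of a continuous orbit equivalence. -/
def OrbitEqFns (A : Matrix (Fin N) (Fin N) ℤ) (B : Matrix (Fin M) (Fin M) ℤ)
    (h : Space A ≃ₜ Space B) (k1 l1 : C(Space A, ℕ)) (k2 l2 : C(Space B, ℕ)) : Prop :=
  (∀ x : Space A, (shift B)^[k1 x] (h (shift A x)) = (shift B)^[l1 x] (h x)) ∧
  (∀ y : Space B, (shift A)^[k2 y] (h.symm (shift B y)) = (shift A)^[l2 y] (h.symm y))

/-- `(X_A, σ_A)` and `(X_B, σ_B)` are continuously orbit equivalent. -/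
def ContOrbitEquiv (A : Matrix (Fin N) (Fin N) ℤ) (B : Matrix (Fin M) (Fin M) ℤ) : Prop :=
  ∃ h : Space A ≃ₜ Space B, ∃ k1 l1 : C(Space A, ℕ), ∃ k2 l2 : C(Space B, ℕ),
    OrbitEqFns A B h k1 l1 k2 l2

/-- One-sided flow equivalence via the homeomorphism `h`. -/
def FlowEquivVia (A : Matrix (Fin N) (Fin N) ℤ) (B : Matrix (Fin M) (Fin M) ℤ)
    (h : Space A ≃ₜ Space B) : Prop :=
  ∃ T₁ : SuspData A, IsSuspTriplet T₁ ∧ ∃ T₂ : SuspData B, IsSuspTriplet T₂ ∧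
  ∃ Φ₁ : Susp T₁ → StdSusp B, Continuous Φ₁ ∧
  ∃ Φ₂ : Susp T₂ → StdSusp A, Continuous Φ₂ ∧
  (∀ (t : ℝ≥0) (p : Susp T₁), Φ₁ (flow T₁ t p) = flow (stdData B) t (Φ₁ p)) ∧
  (∀ x : Space A, Φ₁ (basePoint T₁ x) = stdBase B (h x)) ∧
  (∀ (t : ℝ≥0) (q : Susp T₂), Φ₂ (flow T₂ t q) = flow (stdData A) t (Φ₂ q)) ∧
  (∀ y : Space B, Φ₂ (basePoint T₂ y) = stdBase A (h.symm y))

/-- `(X_A, σ_A)` and `(X_B, σ_B)` are one-sided flow equivalent. -/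
def OneSidedFlowEquiv (A : Matrix (Fin N) (Fin N) ℤ) (B : Matrix (Fin M) (Fin M) ℤ) : Prop :=
  ∃ h : Space A ≃ₜ Space B, FlowEquivVia A B h

/-- `f^m(x) = Σ_{i<m} f(σ_A^i(x))` for integer-valued `f`. -/
def birk (A : Matrix (Fin N) (Fin N) ℤ) (f : Space A → ℤ) (m : ℕ) (x : Space A) : ℤ :=
  ∑ i ∈ Finset.range m, f ((shift A)^[i] x)

/-- `f^m(x) = Σ_{i<m} f(σ_A^i(x))` for real-valued `f`. -/
def birkR (A : Matrix (Fin N) (Fin N) ℤ) (f : Space A → ℝ) (m : ℕ) (x : Space A) : ℝ :=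
  ∑ i ∈ Finset.range m, f ((shift A)^[i] x)

/-- `f^m(x) = Σ_{i<m} f(σ_A^i(x))` for ℕ-valued `f`. -/
def birkN (A : Matrix (Fin N) (Fin N) ℤ) (f : Space A → ℕ) (m : ℕ) (x : Space A) : ℕ :=
  ∑ i ∈ Finset.range m, f ((shift A)^[i] x)

/-- The map `Ψ_h` associated with a continuous orbit equivalence. -/
def psi (A : Matrix (Fin N) (Fin N) ℤ) (B : Matrix (Fin M) (Fin M) ℤ)
    (h : Space A → Space B) (l1 k1 : Space A → ℕ) (f : Space B → ℤ) :
    Space A → ℤ :=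
  fun x => (∑ i ∈ Finset.range (l1 x), f ((shift B)^[i] (h x)))
    - ∑ j ∈ Finset.range (k1 x), f ((shift B)^[j] (h (shift A x)))

/-- The dynamical zeta function `ζ_{A,f}(s)` with potential `f`. -/
noncomputable def zeta (A : Matrix (Fin N) (Fin N) ℤ) (f : Space A → ℤ) (s : ℂ) : ℂ :=
  Complex.exp (∑' n : ℕ, (1 / (n + 1 : ℂ)) *
    ∑' x : {x : Space A // (shift A)^[n + 1] x = x},
      Complex.exp (-s * ((birk A f (n + 1) x.1 : ℤ) : ℂ)))

/-- `γ` is a periodic orbit of `(X_A, σ_A)`. -/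
def IsPerOrbit (A : Matrix (Fin N) (Fin N) ℤ) (γ : Set (Space A)) : Prop :=
  ∃ (x : Space A) (p : ℕ), 0 < p ∧ (shift A)^[p] x = x ∧
    (∀ q : ℕ, 0 < q → (shift A)^[q] x = x → p ≤ q) ∧
    γ = {y | ∃ i : ℕ, i < p ∧ y = (shift A)^[i] x}

/-- `τ` is a primitive periodic orbit of the flow on the one-sided suspension. -/
def IsFlowOrbit {A : Matrix (Fin N) (Fin N) ℤ} (T : SuspData A) (τ : Set (Susp T)) : Prop :=
  ∃ u : Susp T, (∃ t : ℝ≥0, 0 < t ∧ flow T t u = u) ∧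
    τ = Set.range (fun t : ℝ≥0 => flow T t u)

/-- `ℓ(u) = min { t > 0 : φ_{A,t}(u) = u }`. -/
noncomputable def pointLen {A : Matrix (Fin N) (Fin N) ℤ} (T : SuspData A) (u : Susp T) : ℝ≥0 :=
  sInf {t : ℝ≥0 | 0 < t ∧ flow T t u = u}

/-- `ℓ(τ) = min { t > 0 : φ_{A,t}(u) = u for all u ∈ τ }`. -/
noncomputable def orbitLen {A : Matrix (Fin N) (Fin N) ℤ} (T : SuspData A)
    (τ : Set (Susp T)) : ℝ≥0 :=
  sInf {t : ℝ≥0 | 0 < t ∧ ∀ u ∈ τ, flow T t u = u}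

/-- The set `Z(X_A, σ_A)` of dynamical zeta functions of `(X_A, σ_A)` whose potential
functions have class an order unit of `(H^A, H^A_+)`; two such functions are regarded
as the same zeta function when they agree on some right half-plane. -/
def ZetaSet {N : ℕ} (A : Matrix (Fin N) (Fin N) ℤ) : Set (ℂ → ℂ) :=
  {F | ∃ g : C(Space A, ℤ), IsOrderUnit A (cohClass A g) ∧
    ∃ h0 : ℝ, ∀ s : ℂ, h0 < s.re → F s = zeta A (⇑g) s}

section OrbitCocycle

variable {X Y : Type*}

/-- Two points are tail equivalent when their forward orbits meet. -/
def TailRel (σ : X → X) (x x' : X) : Prop := ∃ a b : ℕ, σ^[a] x = σ^[b] x'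

lemma TailRel.refl (σ : X → X) (x : X) : TailRel σ x x := ⟨0, 0, rfl⟩

lemma TailRel.symm {σ : X → X} {x x' : X} (h : TailRel σ x x') : TailRel σ x' x := by
  obtain ⟨a, b, h⟩ := h
  exact ⟨b, a, h.symm⟩

lemma TailRel.trans {σ : X → X} {x y z : X} (h : TailRel σ x y) (h' : TailRel σ y z) :
    TailRel σ x z := by
  obtain ⟨a, b, h⟩ := h
  obtain ⟨c, d, h'⟩ := h'
  refine ⟨c + a, b + d, ?_⟩
  rw [Function.iterate_add_apply, h, ← Function.iterate_add_apply, add_comm,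
    Function.iterate_add_apply, h', ← Function.iterate_add_apply]

/-- Tail equivalence as a setoid. -/
def tailSetoid (σ : X → X) : Setoid X :=
  ⟨TailRel σ, TailRel.refl σ, TailRel.symm, TailRel.trans⟩

lemma tailRel_iterate (σ : X → X) (x : X) (i : ℕ) : TailRel σ x (σ^[i] x) := ⟨i, 0, rfl⟩

lemma TailRel.exists_iterate_eq {σ : X → X} {x y : X} (h : TailRel σ x y) {m n : ℕ}
    (hm : 0 < m) (hx : σ^[m] x = x) (hn : 0 < n) (hy : σ^[n] y = y) :
    ∃ i < Function.minimalPeriod σ x, σ^[i] x = y := by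
  obtain ⟨a, b, h⟩ := h
  have hx' : Function.IsPeriodicPt σ m x := hx
  refine ⟨(n * b - b + a) % Function.minimalPeriod σ x,
    Nat.mod_lt _ (hx'.minimalPeriod_pos hm), ?_⟩
  have hb : n * b - b + b = n * b := Nat.sub_add_cancel (Nat.le_mul_of_pos_left b hn)
  have hy' : Function.IsPeriodicPt σ n y := hy
  rw [Function.iterate_mod_minimalPeriod_eq, Function.iterate_add_apply, h,
    ← Function.iterate_add_apply, hb]
  exact hy'.mul_const b

lemma birkhoffSum_iterate_of_periodic {σ : X → X} (f : X → ℤ) {n : ℕ} {x : X}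
    (hx : σ^[n] x = x) (i : ℕ) : birkhoffSum σ f n (σ^[i] x) = birkhoffSum σ f n x := by
  have h1 := birkhoffSum_add σ f i n x
  have h2 := birkhoffSum_add σ f n i x
  rw [hx, add_comm n i] at h2
  linarith

lemma birkhoffSum_mul_of_periodic {σ : X → X} (f : X → ℤ) {n : ℕ} {x : X}
    (hx : σ^[n] x = x) (j : ℕ) : birkhoffSum σ f (n * j) x = j * birkhoffSum σ f n x := by
  induction j with
  | zero => simp
  | succ j ih =>
    have hx' : Function.IsPeriodicPt σ n x := hx
    have h0 : σ^[n * j] x = x := hx'.mul_const j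
    rw [Nat.mul_succ, birkhoffSum_add, ih, h0]
    push_cast
    ring

/-- The map `h` carries orbits of `σ` to orbits of `τ` with shift exponents `l`, `k`, and `l - k`
is positive along periodic orbits. -/
structure IsOrbitCocycle (σ : X → X) (τ : Y → Y) (h : X → Y) (l k : X → ℕ) : Prop where
  orbit : ∀ x, τ^[l x] (h x) = τ^[k x] (h (σ x))
  pos : ∀ x n, 0 < n → σ^[n] x = x → birkhoffSum σ k n x < birkhoffSum σ l n x

/-- The pullback of a potential along an orbit map. -/
def pullback (σ : X → X) (τ : Y → Y) (h : X → Y) (l k : X → ℕ) (f : Y → ℤ) (x : X) : ℤ :=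
  birkhoffSum τ f (l x) (h x) - birkhoffSum τ f (k x) (h (σ x))

/-- The length in `Y` of the image of an orbit segment of length `n`. -/
def imageLength (σ : X → X) (l k : X → ℕ) (n : ℕ) (x : X) : ℕ :=
  birkhoffSum σ l n x - birkhoffSum σ k n x

variable {σ : X → X} {τ : Y → Y} {h : X → Y} {l k : X → ℕ}

lemma iterate_orbit (horb : ∀ x, τ^[l x] (h x) = τ^[k x] (h (σ x))) (n : ℕ) (x : X) :
    τ^[birkhoffSum σ l n x] (h x) = τ^[birkhoffSum σ k n x] (h (σ^[n] x)) := by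
  induction n with
  | zero => simp
  | succ n ih =>
    rw [birkhoffSum_succ, birkhoffSum_succ, add_comm, Function.iterate_add_apply, ih,
      ← Function.iterate_add_apply, add_comm, Function.iterate_add_apply, horb,
      ← Function.iterate_add_apply, Function.iterate_succ_apply' σ]

lemma birkhoffSum_pullback (horb : ∀ x, τ^[l x] (h x) = τ^[k x] (h (σ x))) (f : Y → ℤ)
    (n : ℕ) (x : X) :
    birkhoffSum σ (pullback σ τ h l k f) n x =
      birkhoffSum τ f (birkhoffSum σ l n x) (h x) -
        birkhoffSum τ f (birkhoffSum σ k n x) (h (σ^[n] x)) := by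
  induction n with
  | zero => simp
  | succ n ih =>
    rw [birkhoffSum_succ, birkhoffSum_succ, birkhoffSum_succ, ih, pullback, birkhoffSum_add,
      iterate_orbit horb, Function.iterate_succ_apply']
    set z := h (σ^[n] x) with hz
    set K := birkhoffSum σ k n x
    have e1 := birkhoffSum_add τ f K (l (σ^[n] x)) z
    have e2 := birkhoffSum_add τ f (l (σ^[n] x)) K z
    have e3 := birkhoffSum_add τ f (k (σ^[n] x)) K (h (σ (σ^[n] x)))
    rw [horb] at e2
    rw [add_comm] at e2
    rw [add_comm K (k _)]
    linarith

lemma tailRel_map (horb : ∀ x, τ^[l x] (h x) = τ^[k x] (h (σ x))) {x x' : X}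
    (hx : TailRel σ x x') : TailRel τ (h x) (h x') := by
  obtain ⟨a, b, hab⟩ := hx
  have key : ∀ n x, TailRel τ (h x) (h (σ^[n] x)) := fun n x => ⟨_, _, iterate_orbit horb n x⟩
  exact (key a x).trans (hab ▸ (key b x').symm)

lemma IsOrbitCocycle.cast_imageLength (H : IsOrbitCocycle σ τ h l k) {n : ℕ} {x : X}
    (hn : 0 < n) (hx : σ^[n] x = x) :
    (imageLength σ l k n x : ℤ) = birkhoffSum σ (fun x => (l x : ℤ) - k x) n x := by
  rw [imageLength, Nat.cast_sub (H.pos x n hn hx).le]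
  simp [birkhoffSum, Finset.sum_sub_distrib]

lemma IsOrbitCocycle.imageLength_pos (H : IsOrbitCocycle σ τ h l k) {n : ℕ} {x : X}
    (hn : 0 < n) (hx : σ^[n] x = x) : 0 < imageLength σ l k n x :=
  Nat.sub_pos_of_lt (H.pos x n hn hx)

lemma IsOrbitCocycle.exists_periodic (H : IsOrbitCocycle σ τ h l k) {n : ℕ} {x : X}
    (hn : 0 < n) (hx : σ^[n] x = x) :
    ∃ y, TailRel τ (h x) y ∧ τ^[imageLength σ l k n x] y = y ∧
      ∀ f, birkhoffSum σ (pullback σ τ h l k f) n x =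
        birkhoffSum τ f (imageLength σ l k n x) y := by
  have h1 := iterate_orbit H.orbit n x
  have hK : birkhoffSum σ k n x + imageLength σ l k n x = birkhoffSum σ l n x :=
    Nat.add_sub_of_le (H.pos x n hn hx).le
  rw [hx] at h1
  refine ⟨τ^[birkhoffSum σ k n x] (h x), tailRel_iterate _ _ _, ?_, fun f => ?_⟩
  · rw [← Function.iterate_add_apply, add_comm, hK, h1]
  · rw [birkhoffSum_pullback H.orbit, hx, ← hK, birkhoffSum_add]
    ring

lemma IsOrbitCocycle.transfer (H : IsOrbitCocycle σ τ h l k) {n r : ℕ} {x : X} {y : Y}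
    (hn : 0 < n) (hx : σ^[n] x = x) (hr : 0 < r) (hy : τ^[r] y = y) (hxy : TailRel τ (h x) y) :
    τ^[imageLength σ l k n x] y = y ∧
      ∀ f, birkhoffSum σ (pullback σ τ h l k f) n x =
        birkhoffSum τ f (imageLength σ l k n x) y := by
  obtain ⟨z, hz, hzp, hzf⟩ := H.exists_periodic hn hx
  obtain ⟨i, -, rfl⟩ := (hz.symm.trans hxy).exists_iterate_eq (H.imageLength_pos hn hx) hzp hr hy
  refine ⟨?_, fun f => ?_⟩
  · rw [← Function.iterate_add_apply, add_comm, Function.iterate_add_apply, hzp]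
  · rw [birkhoffSum_iterate_of_periodic f hzp, hzf]

variable {g : Y → X} {l' k' : Y → ℕ}

lemma imageLength_imageLength (H : IsOrbitCocycle σ τ h l k) (H' : IsOrbitCocycle τ σ g l' k')
    (hone : ∀ x, pullback σ τ h l k (fun y => (l' y : ℤ) - k' y) x = 1)
    {n r : ℕ} {x : X} {y : Y} (hn : 0 < n) (hx : σ^[n] x = x) (hr : 0 < r) (hy : τ^[r] y = y)
    (hxy : TailRel τ (h x) y) :
    imageLength τ l' k' (imageLength σ l k n x) y = n := by
  obtain ⟨h1, h2⟩ := H.transfer hn hx hr hy hxy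
  have h3 := h2 fun y => (l' y : ℤ) - k' y
  rw [← H'.cast_imageLength (H.imageLength_pos hn hx) h1] at h3
  have h4 : birkhoffSum σ (pullback σ τ h l k fun y => (l' y : ℤ) - k' y) n x = n := by
    simp [birkhoffSum, hone]
  exact_mod_cast (h3.symm.trans h4)

lemma imageLength_minimalPeriod (H : IsOrbitCocycle σ τ h l k) (H' : IsOrbitCocycle τ σ g l' k')
    (hg : ∀ x, g (h x) = x)
    (hone : ∀ x, pullback σ τ h l k (fun y => (l' y : ℤ) - k' y) x = 1)
    {n r : ℕ} {x : X} {y : Y} (hn : 0 < n) (hx : σ^[n] x = x) (hr : 0 < r) (hy : τ^[r] y = y)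
    (hxy : TailRel τ (h x) y) :
    Function.minimalPeriod σ x * imageLength σ l k n x = Function.minimalPeriod τ y * n := by
  have hxp : Function.IsPeriodicPt σ n x := hx
  have hyp : Function.IsPeriodicPt τ r y := hy
  set p := Function.minimalPeriod σ x with hp
  set q := Function.minimalPeriod τ y with hq
  have hp0 : 0 < p := hxp.minimalPeriod_pos hn
  have hq0 : 0 < q := hyp.minimalPeriod_pos hr
  have hpx : σ^[p] x = x := Function.iterate_minimalPeriod
  have hqy : τ^[q] y = y := Function.iterate_minimalPeriod
  have hgx : TailRel σ (g y) x := by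
    have := tailRel_map H'.orbit hxy
    rw [hg] at this
    exact this.symm
  have h1 := (H.transfer hp0 hpx hr hy hxy).1
  obtain ⟨a, ha⟩ : q ∣ imageLength σ l k p x := Function.IsPeriodicPt.minimalPeriod_dvd h1
  obtain ⟨b, hb⟩ : p ∣ imageLength τ l' k' q y :=
    Function.IsPeriodicPt.minimalPeriod_dvd (H'.transfer hq0 hqy hn hx hgx).1
  have h2 := imageLength_imageLength H H' hone hp0 hpx hr hy hxy
  have h3 := H'.cast_imageLength (H.imageLength_pos hp0 hpx) h1
  rw [h2, ha, birkhoffSum_mul_of_periodic _ hqy, ← H'.cast_imageLength hq0 hqy, hb] at h3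
  have h4 : a * b = 1 := by
    have : p * 1 = p * (a * b) := by
      have h5 : p = a * (p * b) := by exact_mod_cast h3
      linarith [mul_left_comm a p b]
    exact (Nat.eq_of_mul_eq_mul_left hp0 this).symm
  have ha1 : a = 1 := Nat.eq_one_of_mul_eq_one_right h4
  obtain ⟨j, hj⟩ : p ∣ n := hxp.minimalPeriod_dvd
  have h6 := H.cast_imageLength hn hx
  have h7 : imageLength σ l k n x = j * q := by
    rw [hj, birkhoffSum_mul_of_periodic _ hpx, ← H.cast_imageLength hp0 hpx, ha, ha1, mul_one,
      ← hj] at h6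
    exact_mod_cast h6
  rw [h7, hj]
  ring


/-- Pairs of a period (shifted by one) and a point with this period. -/
abbrev PeriodicPair (σ : X → X) : Type _ := Σ n : ℕ, {x : X // σ^[n + 1] x = x}

lemma tsum_tailRel_fiber (P : PeriodicPair σ → Prop) (G : PeriodicPair σ → ℂ)
    {n : ℕ} {x : X} (hn : 0 < n) (hx : σ^[n] x = x) (v : ℂ)
    (hP : ∀ p, P p ↔ p.1 + 1 = n ∧ TailRel σ x p.2.1) (hG : ∀ p, P p → G p = v) :
    ∑' p : {p // P p}, G p.1 = Function.minimalPeriod σ x * v := by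
  obtain ⟨n, rfl⟩ := Nat.exists_eq_add_of_lt hn
  simp only [zero_add] at *
  have hxp : Function.IsPeriodicPt σ (n + 1) x := hx
  have hmem : ∀ i : ℕ, σ^[n + 1] (σ^[i] x) = σ^[i] x := fun i => by
    rw [← Function.iterate_add_apply, add_comm, Function.iterate_add_apply, hx]
  let φ : Fin (Function.minimalPeriod σ x) → {p // P p} := fun i =>
    ⟨⟨n, σ^[i] x, hmem i⟩, (hP _).2 ⟨rfl, tailRel_iterate _ _ _⟩⟩
  have hφ : Function.Bijective φ := by
    constructor
    · intro i j hij
      have h1 : σ^[i] x = σ^[j] x := by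
        have h2 := congrArg (fun p : {p // P p} => p.1.2.1) hij
        exact h2
      exact Fin.ext ((Function.iterate_eq_iterate_iff_of_lt_minimalPeriod i.2 j.2).1 h1)
    · rintro ⟨⟨m, y, hy⟩, hp⟩
      obtain ⟨h1, h2⟩ := (hP _).1 hp
      obtain rfl : m = n := by simpa using h1
      obtain ⟨i, hi, rfl⟩ := h2.exists_iterate_eq hn hx (Nat.succ_pos m) hy
      exact ⟨⟨i, hi⟩, rfl⟩
  rw [tsum_congr fun p : {p // P p} => hG p.1 p.2, tsum_const, ← Nat.card_eq_of_bijective φ hφ]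
  simp

lemma tsum_fiber {α β : Type*} (π : α → β) {F : α → ℂ} (hF : Summable F) :
    ∑' p, F p = ∑' t, ∑' p : {p // π p = t}, F p := by
  rw [← (Equiv.sigmaFiberEquiv π).tsum_eq F, Summable.tsum_sigma]
  · rfl
  · exact (Equiv.sigmaFiberEquiv π).summable_iff.2 hF

lemma tsum_periodicPair_pullback (H : IsOrbitCocycle σ τ h l k) (H' : IsOrbitCocycle τ σ g l' k')
    (hg : ∀ x, g (h x) = x) (hg' : ∀ y, h (g y) = y)
    (hone : ∀ x, pullback σ τ h l k (fun y => (l' y : ℤ) - k' y) x = 1)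
    (hone' : ∀ y, pullback τ σ g l' k' (fun x => (l x : ℤ) - k x) y = 1)
    (f : Y → ℤ) (w : ℤ → ℂ)
    (hs : Summable fun p : PeriodicPair σ =>
      (1 / (p.1 + 1 : ℂ)) * w (birkhoffSum σ (pullback σ τ h l k f) (p.1 + 1) p.2.1))
    (hs' : Summable fun p : PeriodicPair τ =>
      (1 / (p.1 + 1 : ℂ)) * w (birkhoffSum τ f (p.1 + 1) p.2.1)) :
    ∑' p : PeriodicPair σ,
      (1 / (p.1 + 1 : ℂ)) * w (birkhoffSum σ (pullback σ τ h l k f) (p.1 + 1) p.2.1) =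
    ∑' p : PeriodicPair τ, (1 / (p.1 + 1 : ℂ)) * w (birkhoffSum τ f (p.1 + 1) p.2.1) := by
  let π : PeriodicPair σ → Quotient (tailSetoid τ) × ℕ := fun p =>
    (Quotient.mk _ (h p.2.1), imageLength σ l k (p.1 + 1) p.2.1)
  let π' : PeriodicPair τ → Quotient (tailSetoid τ) × ℕ := fun p =>
    (Quotient.mk _ p.2.1, p.1 + 1)
  have hq : ∀ a b : Y, (Quotient.mk (tailSetoid τ) a = Quotient.mk _ b) ↔ TailRel τ a b :=
    fun a b => Quotient.eq
  rw [tsum_fiber π hs, tsum_fiber π' hs']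
  refine tsum_congr fun t => ?_
  by_cases ht : ∃ p, π' p = t
  · obtain ⟨⟨m, y, hy⟩, rfl⟩ := ht
    have hm : 0 < m + 1 := m.succ_pos
    obtain ⟨x, hyx, hx, -⟩ := H'.exists_periodic hm hy
    set n := imageLength τ l' k' (m + 1) y with hn
    have hn0 : 0 < n := H'.imageLength_pos hm hy
    have hxy : TailRel τ (h x) y := by
      have := tailRel_map H.orbit hyx
      rw [hg'] at this
      exact this.symm
    have hlen : ∀ x', σ^[n] x' = x' → TailRel σ (g y) x' → imageLength σ l k n x' = m + 1 :=
      fun x' hx' hyx' => imageLength_imageLength H' H hone' hm hy hn0 hx' hyx'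
    have hfib : ∀ p, π p = π' ⟨m, y, hy⟩ ↔ p.1 + 1 = n ∧ TailRel σ x p.2.1 := by
      rintro ⟨n', x', hx'⟩
      simp only [π, π', Prod.mk.injEq, hq]
      constructor
      · rintro ⟨h1, h2⟩
        have h3 := imageLength_imageLength H H' hone n'.succ_pos hx' hm hy h1
        rw [Nat.succ_eq_add_one, h2] at h3
        refine ⟨h3.symm, ?_⟩
        have h4 := tailRel_map H'.orbit (hxy.trans h1.symm)
        rwa [hg, hg] at h4
      · rintro ⟨h1, h2⟩
        rw [h1] at hx' ⊢
        exact ⟨(tailRel_map H.orbit h2).symm.trans hxy, hlen x' hx' (hyx.trans h2)⟩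
    have hfib' : ∀ p, π' p = π' ⟨m, y, hy⟩ ↔ p.1 + 1 = m + 1 ∧ TailRel τ y p.2.1 := by
      rintro ⟨m', y', hy'⟩
      simp only [π', Prod.mk.injEq, hq]
      exact ⟨fun h => ⟨h.2, h.1.symm⟩, fun h => ⟨h.2.symm, h.1⟩⟩
    have hS := (H.transfer hn0 hx hm hy hxy).2 f
    rw [hlen x hx hyx] at hS
    refine (tsum_tailRel_fiber (fun p => π p = π' ⟨m, y, hy⟩) (fun p => (1 / (p.1 + 1 : ℂ)) *
        w (birkhoffSum σ (pullback σ τ h l k f) (p.1 + 1) p.2.1)) hn0 hx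
      ((1 / (n : ℂ)) * w (birkhoffSum τ f (m + 1) y)) hfib ?_).trans (Eq.trans ?_
      (tsum_tailRel_fiber (fun p => π' p = π' ⟨m, y, hy⟩) (fun p => (1 / (p.1 + 1 : ℂ)) *
        w (birkhoffSum τ f (p.1 + 1) p.2.1)) hm hy
      ((1 / ((m + 1 : ℕ) : ℂ)) * w (birkhoffSum τ f (m + 1) y)) hfib' ?_).symm)
    rotate_left
    · have h5 := imageLength_minimalPeriod H H' hg hone hn0 hx hm hy hxy
      rw [hlen x hx hyx] at h5
      have h6 : (Function.minimalPeriod σ x : ℂ) * ((m + 1 : ℕ) : ℂ) =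
          Function.minimalPeriod τ y * n := by exact_mod_cast h5
      have hn1 : (n : ℂ) ≠ 0 := by exact_mod_cast hn0.ne'
      have hm1 : ((m + 1 : ℕ) : ℂ) ≠ 0 := by exact_mod_cast hm.ne'
      rw [← mul_assoc, ← mul_assoc]
      congr 1
      field_simp
      rw [h6, mul_comm]
    · rintro ⟨m', y', hy'⟩ hp
      obtain ⟨h1, h2⟩ := (hfib' _).1 hp
      obtain rfl : m' = m := by simpa using h1
      obtain ⟨i, -, rfl⟩ := h2.exists_iterate_eq hm hy hm hy'
      simp only
      rw [birkhoffSum_iterate_of_periodic f hy]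
      push_cast
      rfl
    · rintro ⟨n', x', hx'⟩ hp
      obtain ⟨h1, h2⟩ := (hfib _).1 hp
      simp only at h1 h2 hx' ⊢
      rw [h1] at hx'
      obtain ⟨i, -, rfl⟩ := h2.exists_iterate_eq hn0 hx hn0 hx'
      rw [h1, birkhoffSum_iterate_of_periodic _ hx, hS, ← h1]
      push_cast
      rfl
  · have e' : IsEmpty {p // π' p = t} := ⟨fun p => ht ⟨p.1, p.2⟩⟩
    have e : IsEmpty {p // π p = t} := by
      refine ⟨?_⟩
      rintro ⟨⟨n, x, hx⟩, rfl⟩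
      apply ht
      obtain ⟨y, h1, h2, -⟩ := H.exists_periodic n.succ_pos hx
      have h3 := H.imageLength_pos n.succ_pos hx
      obtain ⟨m, hm⟩ := Nat.exists_eq_add_of_lt h3
      rw [zero_add] at hm
      rw [hm] at h2
      refine ⟨⟨m, y, h2⟩, ?_⟩
      simp only [π, π', Prod.mk.injEq, hq]
      exact ⟨h1.symm, hm.symm⟩
    rw [tsum_empty, tsum_empty]

end OrbitCocycle
section Symbolic

variable {A : Matrix (Fin N) (Fin N) ℤ}

lemma iterate_shift_apply (x : Space A) (n i : ℕ) : ((shift A)^[n] x).1 i = x.1 (n + i) := by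
  induction n generalizing x with
  | zero => simp
  | succ n ih =>
    rw [Function.iterate_succ_apply, ih]
    change x.1 (n + i + 1) = _
    exact congrArg x.1 (by omega)

instance compactSpace_space : CompactSpace (Space A) := by
  apply isCompact_iff_compactSpace.1
  apply IsClosed.isCompact
  have : {x : ℕ → Fin N | ∀ n, A (x n) (x (n + 1)) = 1} =
      ⋂ n, (fun x : ℕ → Fin N => (x n, x (n + 1))) ⁻¹' {p | A p.1 p.2 = 1} := by
    ext x
    simp
  change IsClosed {x : ℕ → Fin N | ∀ n, A (x n) (x (n + 1)) = 1}
  rw [this]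
  refine isClosed_iInter fun n => IsClosed.preimage ?_ (isClosed_discrete _)
  exact (continuous_apply n).prodMk (continuous_apply (n + 1))

lemma exists_cylinder_subset {U : Set (Space A)} (hU : IsOpen U) {x : Space A} (hx : x ∈ U) :
    ∃ L, ∀ y : Space A, (∀ i < L, y.1 i = x.1 i) → y ∈ U := by
  obtain ⟨V, hV, rfl⟩ := isOpen_induced_iff.1 hU
  obtain ⟨W, ⟨z, L, rfl⟩, hxW, hWV⟩ :=
    (PiNat.isTopologicalBasis_cylinders fun _ : ℕ => Fin N).exists_subset_of_mem_open hx hV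
  refine ⟨L, fun y hy => hWV ?_⟩
  rw [PiNat.mem_cylinder_iff] at hxW ⊢
  exact fun i hi => (hy i hi).trans (hxW i hi)

lemma isOpen_cylinder (x : Space A) (L : ℕ) : IsOpen {y : Space A | ∀ i < L, y.1 i = x.1 i} := by
  have : {y : Space A | ∀ i < L, y.1 i = x.1 i} =
      Subtype.val ⁻¹' PiNat.cylinder x.1 L := by
    ext y
    simp [PiNat.mem_cylinder_iff]
  rw [this]
  exact (PiNat.isOpen_cylinder _ _ _).preimage continuous_subtype_val

lemma exists_uniform_cylinder (f : C(Space A, ℤ)) :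
    ∃ L, ∀ x y : Space A, (∀ i < L, y.1 i = x.1 i) → f y = f x := by
  have h1 : ∀ x : Space A, ∃ L, ∀ y : Space A, (∀ i < L, y.1 i = x.1 i) → f y = f x := fun x =>
    exists_cylinder_subset (U := f ⁻¹' {f x}) ((isOpen_discrete _).preimage f.continuous) rfl
  choose L hL using h1
  obtain ⟨t, -, ht⟩ := isCompact_univ.elim_nhds_subcover
    (fun x => {y : Space A | ∀ i < L x, y.1 i = x.1 i})
    (fun x _ => (isOpen_cylinder x (L x)).mem_nhds fun _ _ => rfl)
  refine ⟨t.sup L, fun x y hxy => ?_⟩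
  obtain ⟨z, hz, hxz⟩ := Set.mem_iUnion₂.1 (ht (Set.mem_univ x))
  have hle : L z ≤ t.sup L := Finset.le_sup hz
  rw [hL z x hxz, hL z y fun i hi => (hxy i (hi.trans_le hle)).trans (hxz i hi)]

lemma exists_bound (f : C(Space A, ℤ)) : ∃ K : ℕ, 0 < K ∧ ∀ x, |f x| ≤ K := by
  have h1 : (Set.range f).Finite := (isCompact_range f.continuous).finite_of_discrete
  obtain ⟨K, hK⟩ := (h1.image Int.natAbs).bddAbove
  refine ⟨K + 1, K.succ_pos, fun x => ?_⟩
  have h2 : (f x).natAbs ≤ K := hK ⟨f x, ⟨x, rfl⟩, rfl⟩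
  rw [Int.abs_eq_natAbs]
  exact_mod_cast h2.trans K.le_succ

/-- Prepending an admissible symbol. -/
def consPt (i : Fin N) (x : Space A) (h : A i (x.1 0) = 1) : Space A :=
  ⟨fun n => Nat.casesOn n i x.1, fun n => by
    cases n with
    | zero => exact h
    | succ n => exact x.2 n⟩

lemma shift_consPt (i : Fin N) (x : Space A) (h : A i (x.1 0) = 1) : shift A (consPt i x h) = x :=
  rfl

lemma exists_iterate_eq_of_pow_ne_zero (h01 : IsZeroOne A) (m : ℕ) (i : Fin N) (y : Space A)
    (h : (A ^ m) i (y.1 0) ≠ 0) : ∃ z : Space A, z.1 0 = i ∧ (shift A)^[m] z = y := by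
  induction m generalizing i with
  | zero =>
    refine ⟨y, ?_, rfl⟩
    by_contra hne
    exact h (by rw [pow_zero, Matrix.one_apply_ne (Ne.symm hne)])
  | succ m ih =>
    rw [pow_succ', Matrix.mul_apply] at h
    obtain ⟨j, -, hj⟩ := Finset.exists_ne_zero_of_sum_ne_zero h
    obtain ⟨z, hz0, hz⟩ := ih j (right_ne_zero_of_mul hj)
    have hA : A i (z.1 0) = 1 := by
      rw [hz0]
      exact (h01 i j).resolve_left (left_ne_zero_of_mul hj)
    exact ⟨consPt i z hA, rfl, by rw [Function.iterate_succ_apply, shift_consPt, hz]⟩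

/-- Replacing the tail of `x` from position `L` on. -/
def splice (x z : Space A) (L : ℕ) (h : z.1 0 = x.1 L) : Space A :=
  ⟨fun n => if n < L then x.1 n else z.1 (n - L), fun n => by
    by_cases h1 : n + 1 < L
    · simpa [h1, (Nat.lt_succ_self n).trans h1] using x.2 n
    · by_cases h2 : n < L
      · obtain rfl : n + 1 = L := by omega
        simpa [h] using x.2 n
      · have h3 : n + 1 - L = n - L + 1 := by omega
        simpa [h1, h2, h3] using z.2 (n - L)⟩

lemma splice_apply_lt (x z : Space A) (L : ℕ) (h : z.1 0 = x.1 L) {i : ℕ} (hi : i < L) :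
    (splice x z L h).1 i = x.1 i := if_pos hi

lemma splice_apply_add (x z : Space A) (L : ℕ) (h : z.1 0 = x.1 L) (i : ℕ) :
    (splice x z L h).1 (L + i) = z.1 i := by
  simp [splice]

/-- The periodic point repeating the first `p` symbols of `w`. -/
def periodize (w : Space A) (p : ℕ) (hp : 0 < p) (h : w.1 p = w.1 0) : Space A :=
  ⟨fun n => w.1 (n % p), fun n => by
    have h1 : n % p < p := Nat.mod_lt _ hp
    by_cases h2 : n % p + 1 < p
    · have h3 : (n + 1) % p = n % p + 1 := by
        rw [← Nat.mod_add_mod, Nat.mod_eq_of_lt h2]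
      change A (w.1 (n % p)) (w.1 ((n + 1) % p)) = 1
      rw [h3]
      exact w.2 _
    · have h4 : n % p + 1 = p := by omega
      have h3 : (n + 1) % p = 0 := by rw [← Nat.mod_add_mod, h4, Nat.mod_self]
      have h5 := w.2 (n % p)
      rw [h4, h] at h5
      change A (w.1 (n % p)) (w.1 ((n + 1) % p)) = 1
      rwa [h3]⟩

lemma shift_iterate_periodize (w : Space A) (p : ℕ) (hp : 0 < p) (h : w.1 p = w.1 0) :
    (shift A)^[p] (periodize w p hp h) = periodize w p hp h := by
  ext i
  rw [iterate_shift_apply]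
  simp [periodize]

lemma exists_periodic_extension (h01 : IsZeroOne A) (hirr : IsIrreducible A) :
    ∃ R : ℕ, ∀ (y : Space A) (n : ℕ), ∃ (z : Space A) (p : ℕ), n < p ∧ p ≤ n + R ∧
      (shift A)^[p] z = z ∧ ∀ i < n, z.1 i = y.1 i := by
  choose m hm0 hm using hirr
  refine ⟨Finset.univ.sup fun q : Fin N × Fin N => m q.1 q.2, fun y n => ?_⟩
  obtain ⟨z, hz0, hz⟩ := exists_iterate_eq_of_pow_ne_zero h01 _ _ y (hm (y.1 n) (y.1 0))
  set q := m (y.1 n) (y.1 0) with hq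
  have hq0 : 0 < q := hm0 _ _
  have hw : (splice y z n hz0).1 (n + q) = (splice y z n hz0).1 0 := by
    have h1 : z.1 q = y.1 0 := by rw [← hz, iterate_shift_apply, add_zero]
    rw [splice_apply_add, h1]
    rcases Nat.eq_zero_or_pos n with rfl | hn
    · exact hz0.symm
    · rw [splice_apply_lt _ _ _ _ hn]
  have hp : 0 < n + q := by omega
  refine ⟨periodize _ (n + q) hp hw, n + q, by omega, ?_,
    shift_iterate_periodize _ _ _ _, fun i hi => ?_⟩
  · have : q ≤ Finset.univ.sup fun q : Fin N × Fin N => m q.1 q.2 :=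
      Finset.le_sup (f := fun q : Fin N × Fin N => m q.1 q.2)
        (Finset.mem_univ (y.1 n, y.1 0))
    omega
  · change (splice y z n hz0).1 (i % (n + q)) = _
    rw [Nat.mod_eq_of_lt (by omega), splice_apply_lt _ _ _ _ hi]

lemma exists_birkhoffSum_lower_bound (h01 : IsZeroOne A) (hirr : IsIrreducible A)
    (f : C(Space A, ℤ))
    (hf : ∀ x p, 0 < p → (shift A)^[p] x = x → 0 ≤ birkhoffSum (shift A) f p x) :
    ∃ C : ℤ, ∀ n x, C ≤ birkhoffSum (shift A) f n x := by
  obtain ⟨L, hL⟩ := exists_uniform_cylinder f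
  obtain ⟨K, -, hK⟩ := exists_bound f
  obtain ⟨R, hR⟩ := exists_periodic_extension h01 hirr
  refine ⟨-((L + R : ℕ) * K : ℤ), fun n y => ?_⟩
  obtain ⟨z, p, hnp, hp, hz, hzy⟩ := hR y (n + L)
  have h1 : birkhoffSum (shift A) f n z = birkhoffSum (shift A) f n y := by
    refine Finset.sum_congr rfl fun i hi => hL _ _ fun j hj => ?_
    rw [iterate_shift_apply, iterate_shift_apply]
    exact hzy _ (by have := Finset.mem_range.1 hi; omega)
  have h2 := hf z p (by omega) hz
  obtain ⟨r, rfl⟩ := Nat.exists_eq_add_of_le (show n ≤ p by omega)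
  rw [birkhoffSum_add, h1] at h2
  have h3 : birkhoffSum (shift A) f r ((shift A)^[n] z) ≤ r * K := by
    refine (Finset.sum_le_card_nsmul _ _ (K : ℤ) fun i _ => (le_abs_self _).trans (hK _)).trans ?_
    simp
  have h4 : (r : ℤ) * K ≤ (L + R : ℕ) * K := by
    apply mul_le_mul_of_nonneg_right _ (Int.natCast_nonneg K)
    exact_mod_cast (show r ≤ L + R by omega)
  linarith

lemma continuous_of_cylinder {f : Space A → ℤ} (L : ℕ)
    (hL : ∀ x y : Space A, (∀ i < L, y.1 i = x.1 i) → f y = f x) : Continuous f := by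
  refine continuous_iff_continuousAt.2 fun x => ?_
  refine (continuousAt_const (y := f x)).congr ?_
  filter_upwards [(isOpen_cylinder x L).mem_nhds fun _ _ => rfl] with y hy
  exact (hL x y hy).symm

lemma cohClass_mem_cohPos (h01 : IsZeroOne A) (hirr : IsIrreducible A) (f : C(Space A, ℤ))
    (hf : ∀ x p, 0 < p → (shift A)^[p] x = x → 0 ≤ birkhoffSum (shift A) f p x) :
    cohClass A f ∈ CohPos A := by
  obtain ⟨L, hL⟩ := exists_uniform_cylinder f
  obtain ⟨C, hC⟩ := exists_birkhoffSum_lower_bound h01 hirr f hf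
  let S : Space A → Set ℤ := fun x =>
    {v | ∃ (y : Space A) (n : ℕ), (∀ i < L, y.1 i = x.1 i) ∧ birkhoffSum (shift A) f n y = v}
  have hbdd : ∀ x, BddBelow (S x) := fun x => ⟨C, by rintro v ⟨y, n, -, rfl⟩; exact hC n y⟩
  have hne : ∀ x, (S x).Nonempty := fun x => ⟨0, x, 0, fun _ _ => rfl, by simp⟩
  have hg : Continuous fun x => sInf (S x) := by
    refine continuous_of_cylinder L fun x y hxy => ?_
    have : S y = S x := by
      ext v
      constructor
      · rintro ⟨z, n, hz, hv⟩
        exact ⟨z, n, fun i hi => (hz i hi).trans (hxy i hi), hv⟩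
      · rintro ⟨z, n, hz, hv⟩
        exact ⟨z, n, fun i hi => (hz i hi).trans (hxy i hi).symm, hv⟩
    rw [this]
  let g : C(Space A, ℤ) := ⟨_, hg⟩
  refine ⟨f - (g - g.comp (shiftMap A)), fun x => ?_, ?_⟩
  · have key : sInf (S x) ≤ f x + sInf (S (shift A x)) := by
      obtain ⟨y, n, hy, hv⟩ := Int.csInf_mem (hne (shift A x)) (hbdd _)
      rcases Nat.eq_zero_or_pos L with rfl | hL0
      · have h1 : sInf (S x) ≤ birkhoffSum (shift A) f (1 + n) x :=
          csInf_le (hbdd x) ⟨x, _, fun _ _ => rfl, rfl⟩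
        have h2 : birkhoffSum (shift A) f n (shift A x) = birkhoffSum (shift A) f n y :=
          Finset.sum_congr rfl fun i _ => hL _ _ fun j hj => absurd hj (Nat.not_lt_zero j)
        rw [birkhoffSum_add, birkhoffSum_one, Function.iterate_one, h2, hv] at h1
        exact h1
      · have hA : A (x.1 0) (y.1 0) = 1 := by
          rw [hy 0 hL0]
          exact x.2 0
        have hc : ∀ i < L, (consPt (x.1 0) y hA).1 i = x.1 i := by
          intro i hi
          cases i with
          | zero => rfl
          | succ i => exact hy i (by omega)
        have h1 : sInf (S x) ≤ birkhoffSum (shift A) f (1 + n) (consPt (x.1 0) y hA) :=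
          csInf_le (hbdd x) ⟨_, _, hc, rfl⟩
        rw [birkhoffSum_add, birkhoffSum_one, Function.iterate_one, shift_consPt, hv,
          hL _ _ hc] at h1
        exact h1
    change 0 ≤ f x - (sInf (S x) - sInf (S (shift A x)))
    linarith
  · refine (QuotientAddGroup.eq).2 (AddSubgroup.subset_closure ⟨-g, ?_⟩)
    ext x
    simp
    ring

lemma birkhoffSum_eq_zero_of_mem_cobdySubgroup {f : C(Space A, ℤ)} (hf : f ∈ cobdySubgroup A)
    {x : Space A} {p : ℕ} (hx : (shift A)^[p] x = x) : birkhoffSum (shift A) f p x = 0 := by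
  induction hf using AddSubgroup.closure_induction with
  | mem f hf =>
    obtain ⟨g, rfl⟩ := hf
    have h1 : birkhoffSum (shift A) (g - g.comp (shiftMap A) : C(Space A, ℤ)) p x =
        ∑ i ∈ Finset.range p, (g ((shift A)^[i] x) - g ((shift A)^[i + 1] x)) :=
      Finset.sum_congr rfl fun i _ => by
        rw [Function.iterate_succ_apply']
        rfl
    rw [h1, Finset.sum_range_sub', hx]
    simp
  | zero => simp [birkhoffSum]
  | add f g _ _ hf hg =>
    have : birkhoffSum (shift A) (f + g : C(Space A, ℤ)) p x =
      birkhoffSum (shift A) f p x + birkhoffSum (shift A) g p x := Finset.sum_add_distrib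
    rw [this, hf, hg, add_zero]
  | neg f _ hf =>
    have : birkhoffSum (shift A) (-f : C(Space A, ℤ)) p x = -birkhoffSum (shift A) f p x :=
      Finset.sum_neg_distrib _
    rw [this, hf, neg_zero]

/-- Some multiple of the sums of `f` over periodic orbits dominates the period. -/
def PeriodicallyPositive (A : Matrix (Fin N) (Fin N) ℤ) (f : Space A → ℤ) : Prop :=
  ∃ m : ℕ, 0 < m ∧ ∀ x p, 0 < p → (shift A)^[p] x = x → (p : ℤ) ≤ m * birkhoffSum (shift A) f p x

lemma PeriodicallyPositive.of_isOrderUnit {f : C(Space A, ℤ)} (hf : IsOrderUnit A (cohClass A f)) :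
    PeriodicallyPositive A f := by
  obtain ⟨-, h⟩ := hf
  obtain ⟨m, hm, F, hF, h⟩ := h (cohClass A 1)
  refine ⟨m, hm, fun x p _ hx => ?_⟩
  have h1 : -(m • f - 1) + F ∈ cobdySubgroup A := QuotientAddGroup.eq.1 h
  have h2 := birkhoffSum_eq_zero_of_mem_cobdySubgroup h1 hx
  have h3 : birkhoffSum (shift A) (-(m • f - 1) + F : C(Space A, ℤ)) p x =
      -(m * birkhoffSum (shift A) f p x - p) + birkhoffSum (shift A) F p x := by
    simp [birkhoffSum, Finset.sum_add_distrib, Finset.mul_sum]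
  have h4 : 0 ≤ birkhoffSum (shift A) F p x := Finset.sum_nonneg fun i _ => hF _
  linarith

lemma PeriodicallyPositive.isOrderUnit (h01 : IsZeroOne A) (hirr : IsIrreducible A)
    {f : C(Space A, ℤ)} (hf : PeriodicallyPositive A f) : IsOrderUnit A (cohClass A f) := by
  obtain ⟨m, hm, hf⟩ := hf
  refine ⟨cohClass_mem_cohPos h01 hirr f fun x p hp hx => ?_, fun c => ?_⟩
  · have h1 := hf x p hp hx
    by_contra! h2
    have : (m : ℤ) * birkhoffSum (shift A) f p x < 0 :=
      mul_neg_of_pos_of_neg (by exact_mod_cast hm) h2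
    omega
  · obtain ⟨g, rfl⟩ := QuotientAddGroup.mk_surjective c
    obtain ⟨K, hK0, hK⟩ := exists_bound g
    refine ⟨K * m, Nat.mul_pos hK0 hm, ?_⟩
    refine cohClass_mem_cohPos h01 hirr ((K * m) • f - g) fun x p hp hx => ?_
    have h3 : birkhoffSum (shift A) ((K * m) • f - g : C(Space A, ℤ)) p x =
        K * (m * birkhoffSum (shift A) f p x) - birkhoffSum (shift A) g p x := by
      simp [birkhoffSum, Finset.mul_sum, mul_assoc]
    have h4 : birkhoffSum (shift A) g p x ≤ p * K := by
      refine (Finset.sum_le_card_nsmul _ _ (K : ℤ) fun i _ =>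
        (le_abs_self _).trans (hK _)).trans ?_
      simp
    have h5 := mul_le_mul_of_nonneg_left (hf x p hp hx) (Int.natCast_nonneg K)
    rw [h3]
    linarith [mul_comm (p : ℤ) K]

end Symbolic

section Aperiodic

variable {A : Matrix (Fin N) (Fin N) ℤ}

lemma exists_successor (h01 : IsZeroOne A) (hirr : IsIrreducible A) (i : Fin N) :
    ∃ j, A i j = 1 := by
  obtain ⟨m, hm, h⟩ := hirr i i
  obtain ⟨m, rfl⟩ := Nat.exists_eq_succ_of_ne_zero hm.ne'
  rw [pow_succ', Matrix.mul_apply] at h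
  obtain ⟨j, -, hj⟩ := Finset.exists_ne_zero_of_sum_ne_zero h
  exact ⟨j, (h01 i j).resolve_left (left_ne_zero_of_mul hj)⟩

lemma exists_branching (h01 : IsZeroOne A) (hirr : IsIrreducible A)
    (hnp : ¬ IsPermutationMatrix A) : ∃ i j j', j ≠ j' ∧ A i j = 1 ∧ A i j' = 1 := by
  by_contra! hcon
  have hpred : ∀ j, ∃ i, A i j = 1 := fun j => by
    obtain ⟨m, hm, h⟩ := hirr j j
    obtain ⟨m, rfl⟩ := Nat.exists_eq_succ_of_ne_zero hm.ne'
    rw [pow_succ, Matrix.mul_apply] at h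
    obtain ⟨i, -, hi⟩ := Finset.exists_ne_zero_of_sum_ne_zero h
    exact ⟨i, (h01 i j).resolve_left (right_ne_zero_of_mul hi)⟩
  choose s hs using exists_successor h01 hirr
  have huniq : ∀ i j, A i j = 1 → s i = j := fun i j hij => by
    by_contra hne
    exact hcon i (s i) j hne (hs i) hij
  have hsurj : Function.Surjective s := fun j => by
    obtain ⟨i, hi⟩ := hpred j
    exact ⟨i, huniq i j hi⟩
  refine hnp ⟨Equiv.ofBijective s ⟨Finite.injective_iff_surjective.2 hsurj, hsurj⟩, fun i j => ?_⟩
  change A i j = if s i = j then 1 else 0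
  split_ifs with h
  · rw [← h, hs]
  · exact (h01 i j).resolve_right fun h' => h (huniq i j h')

lemma exists_point_from (h01 : IsZeroOne A) (hirr : IsIrreducible A) (i : Fin N) :
    ∃ x : Space A, x.1 0 = i := by
  choose s hs using exists_successor h01 hirr
  refine ⟨⟨fun n => s^[n] i, fun n => ?_⟩, rfl⟩
  change A (s^[n] i) (s^[n + 1] i) = 1
  rw [Function.iterate_succ_apply']
  exact hs _

lemma not_isOpen_singleton (h01 : IsZeroOne A) (hirr : IsIrreducible A)
    (hnp : ¬ IsPermutationMatrix A) (x : Space A) : ¬ IsOpen {x} := by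
  intro hopen
  obtain ⟨L, hL⟩ := exists_cylinder_subset hopen rfl
  obtain ⟨i, j, j', hne, hj, hj'⟩ := exists_branching h01 hirr hnp
  obtain ⟨m, -, hm⟩ := hirr (x.1 L) i
  have key : ∀ j, A i j = 1 → x.1 (L + (m + 1)) = j := by
    intro j hj
    obtain ⟨u, rfl⟩ := exists_point_from h01 hirr j
    obtain ⟨z, hz0, hz⟩ := exists_iterate_eq_of_pow_ne_zero h01 m (x.1 L) (consPt i u hj) hm
    have h1 : splice x z L hz0 = x := hL _ fun n hn => splice_apply_lt _ _ _ _ hn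
    rw [← h1, splice_apply_add, ← iterate_shift_apply, hz]
    rfl
  exact hne ((key j hj).symm.trans (key j' hj'))

lemma eq_of_eventually_periodic {a b : ℕ} (hab : a < b) {x y : Space A}
    (hx : (shift A)^[a] x = (shift A)^[b] x) (hy : (shift A)^[a] y = (shift A)^[b] y)
    (hxy : ∀ i < b, x.1 i = y.1 i) : x = y := by
  have step : ∀ z : Space A, (shift A)^[a] z = (shift A)^[b] z → ∀ i, z.1 (b + i) = z.1 (a + i) :=
    fun z hz i => by rw [← iterate_shift_apply, ← iterate_shift_apply, hz]
  ext i
  congr 1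
  induction i using Nat.strong_induction_on with
  | _ i ih =>
    by_cases hi : i < b
    · exact hxy i hi
    · obtain ⟨j, rfl⟩ := Nat.exists_eq_add_of_le (not_lt.1 hi)
      rw [step x hx, step y hy, ih (a + j) (by omega)]

lemma finite_eventually_periodic (A : Matrix (Fin N) (Fin N) ℤ) {a b : ℕ} (hab : a < b) :
    Finite {x : Space A // (shift A)^[a] x = (shift A)^[b] x} ∧
      Nat.card {x : Space A // (shift A)^[a] x = (shift A)^[b] x} ≤ N ^ b := by
  let φ : {x : Space A // (shift A)^[a] x = (shift A)^[b] x} → (Fin b → Fin N) :=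
    fun x i => x.1.1 i
  have hφ : Function.Injective φ := fun x y hxy =>
    Subtype.ext (eq_of_eventually_periodic hab x.2 y.2 fun i hi => congrFun hxy ⟨i, hi⟩)
  refine ⟨Finite.of_injective φ hφ, (Nat.card_le_card_of_injective φ hφ).trans ?_⟩
  simp

lemma dense_aperiodic (h01 : IsZeroOne A) (hirr : IsIrreducible A)
    (hnp : ¬ IsPermutationMatrix A) :
    Dense {x : Space A | ∀ a b, (shift A)^[a] x = (shift A)^[b] x → a = b} := by
  let S : Set (Space A) :=
    ⋃ q : {q : ℕ × ℕ // q.1 < q.2}, {x | (shift A)^[q.1.1] x = (shift A)^[q.1.2] x}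
  have hS : S.Countable := Set.countable_iUnion fun q =>
    (Set.finite_coe_iff.1 (finite_eventually_periodic A q.2).1).countable
  have hd : Dense (⋂ x ∈ S, {x}ᶜ : Set (Space A)) :=
    dense_biInter_of_isOpen (fun x _ => isOpen_compl_singleton) hS fun x _ =>
      dense_compl_singleton_iff_not_open.2 (not_isOpen_singleton h01 hirr hnp x)
  refine hd.mono fun x hx a b hab => ?_
  have hxS : x ∉ S := fun h => by
    have := Set.mem_iInter₂.1 hx x h
    exact this rfl
  by_contra hne
  rcases lt_or_gt_of_ne hne with h | h
  · exact hxS (Set.mem_iUnion.2 ⟨⟨(a, b), h⟩, hab⟩)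
  · exact hxS (Set.mem_iUnion.2 ⟨⟨(b, a), h⟩, hab.symm⟩)

lemma continuous_birkhoffSum_comp {X Y : Type*} [TopologicalSpace X] [TopologicalSpace Y]
    {τ : Y → Y} (hτ : Continuous τ) {f : Y → ℤ} (hf : Continuous f) {l : X → ℕ}
    (hl : Continuous l) {φ : X → Y} (hφ : Continuous φ) :
    Continuous fun x => birkhoffSum τ f (l x) (φ x) := by
  refine continuous_iff_continuousAt.2 fun x => ?_
  have h1 : Continuous fun y => birkhoffSum τ f (l x) (φ y) :=
    continuous_finsetSum _ fun i _ => hf.comp ((hτ.iterate i).comp hφ)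
  refine h1.continuousAt.congr ?_
  filter_upwards [((isOpen_discrete {l x}).preimage hl).mem_nhds rfl] with y hy
  rw [show l y = l x from hy]

lemma continuous_pullback {X Y : Type*} [TopologicalSpace X] [TopologicalSpace Y]
    {σ : X → X} {τ : Y → Y} (hσ : Continuous σ) (hτ : Continuous τ) {f : Y → ℤ}
    (hf : Continuous f) {l k : X → ℕ} (hl : Continuous l) (hk : Continuous k) {h : X → Y}
    (hh : Continuous h) : Continuous (pullback σ τ h l k f) :=
  (continuous_birkhoffSum_comp hτ hf hl hh).sub
    (continuous_birkhoffSum_comp hτ hf hk (hh.comp hσ))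

lemma pullback_sub_eq_one_of_aperiodic {X Y : Type*} {σ : X → X} {τ : Y → Y} {h : X → Y}
    {g : Y → X} {l k : X → ℕ} {l' k' : Y → ℕ} (horb : ∀ x, τ^[l x] (h x) = τ^[k x] (h (σ x)))
    (horb' : ∀ y, σ^[l' y] (g y) = σ^[k' y] (g (τ y))) (hg : ∀ x, g (h x) = x)
    {x : X} (hx : ∀ a b, σ^[a] x = σ^[b] x → a = b) :
    pullback σ τ h l k (fun y => (l' y : ℤ) - k' y) x = 1 := by
  have h1 := iterate_orbit horb' (l x) (h x)
  have h2 := iterate_orbit horb' (k x) (h (σ x))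
  rw [hg] at h1 h2
  rw [horb] at h1
  have hcast : ∀ n y, birkhoffSum τ (fun y => (l' y : ℤ) - k' y) n y =
      (birkhoffSum τ l' n y : ℕ) - (birkhoffSum τ k' n y : ℕ) := fun n y => by
    simp [birkhoffSum, Finset.sum_sub_distrib]
  rw [pullback, hcast, hcast]
  set L₁ := birkhoffSum τ l' (l x) (h x)
  set K₁ := birkhoffSum τ k' (l x) (h x)
  set L₂ := birkhoffSum τ l' (k x) (h (σ x))
  set K₂ := birkhoffSum τ k' (k x) (h (σ x))
  have h3 : σ^[K₂ + L₁] x = σ^[K₁ + L₂ + 1] x := by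
    rw [Function.iterate_add_apply, h1, ← Function.iterate_add_apply, add_comm K₂,
      Function.iterate_add_apply, ← h2, ← Function.iterate_add_apply, ← Function.iterate_succ_apply]
  have h4 := hx _ _ h3
  omega

lemma pullback_sub_eq_one (h01 : IsZeroOne A) (hirr : IsIrreducible A)
    (hnp : ¬ IsPermutationMatrix A) {B : Matrix (Fin M) (Fin M) ℤ} (h : Space A ≃ₜ Space B)
    {l k : C(Space A, ℕ)} {l' k' : C(Space B, ℕ)}
    (horb : ∀ x, (shift B)^[l x] (h x) = (shift B)^[k x] (h (shift A x)))
    (horb' : ∀ y, (shift A)^[l' y] (h.symm y) = (shift A)^[k' y] (h.symm (shift B y)))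
    (x : Space A) :
    pullback (shift A) (shift B) h l k (fun y => (l' y : ℤ) - k' y) x = 1 := by
  have hc : Continuous fun y : Space B => (l' y : ℤ) - k' y :=
    (continuous_of_discreteTopology.comp l'.continuous).sub
      (continuous_of_discreteTopology.comp k'.continuous)
  refine congrFun (Continuous.ext_on (dense_aperiodic h01 hirr hnp)
    (continuous_pullback (continuous_shift A) (continuous_shift B) hc l.continuous k.continuous
      h.continuous) (continuous_const (y := (1 : ℤ))) fun x hx => ?_) x
  exact pullback_sub_eq_one_of_aperiodic horb horb' h.symm_apply_apply hx

end Aperiodic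

section Suspension

variable {A : Matrix (Fin N) (Fin N) ℤ} {B : Matrix (Fin M) (Fin M) ℤ}

lemma iterate_floor_eq_of_eqvGen {p q : BaseSpace (stdData B)}
    (h : Relation.EqvGen (SuspRel (stdData B)) p q) :
    (shift B)^[⌊p.1.2⌋₊] p.1.1 = (shift B)^[⌊q.1.2⌋₊] q.1.1 := by
  induction h with
  | rel p q hpq =>
    obtain ⟨h1, h2⟩ := hpq
    have h1 : (1 : ℝ) ≤ p.1.2 := h1
    have h3 : q.1.2 = p.1.2 - 1 := by
      rw [h2]
      simp [cFun, stdData]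
    have h4 : 1 ≤ ⌊p.1.2⌋₊ := Nat.one_le_floor_iff _ |>.2 h1
    rw [h3, Nat.floor_sub_one, h2]
    rw [← Function.iterate_succ_apply, Nat.succ_eq_add_one, Nat.sub_add_cancel h4]
  | refl p => rfl
  | symm p q _ ih => exact ih.symm
  | trans p q r _ _ ih1 ih2 => exact ih1.trans ih2

lemma orbit_eq_of_flow_map {T : SuspData A} {h : Space A → Space B} {Φ : Susp T → StdSusp B}
    (hflow : ∀ (t : ℝ≥0) (p : Susp T), Φ (flow T t p) = flow (stdData B) t (Φ p))
    (hbase : ∀ x, Φ (basePoint T x) = stdBase B (h x)) {x : Space A} {n m : ℕ}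
    (hn : T.l x - T.b x = n) (hm : T.k x - T.b (shift A x) = m) :
    (shift B)^[n] (h x) = (shift B)^[m] (h (shift A x)) := by
  have h1 : flow T n (basePoint T x) = flow T m (basePoint T (shift A x)) := by
    refine Quotient.sound (Relation.EqvGen.rel _ _ ⟨?_, ?_⟩)
    · change T.l x ≤ T.b x + ((n : ℝ≥0) : ℝ)
      rw [NNReal.coe_natCast]
      linarith
    · change (shift A x, T.b (shift A x) + ((m : ℝ≥0) : ℝ)) =
        (shift A x, T.b x + ((n : ℝ≥0) : ℝ) - (T.l x - T.k x))
      rw [NNReal.coe_natCast, NNReal.coe_natCast]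
      congr 1
      linarith
  have h2 := congrArg Φ h1
  rw [hflow, hflow, hbase, hbase] at h2
  have h3 := iterate_floor_eq_of_eqvGen (Quotient.exact h2)
  change (shift B)^[⌊(0 : ℝ) + ((n : ℝ≥0) : ℝ)⌋₊] (h x) =
    (shift B)^[⌊(0 : ℝ) + ((m : ℝ≥0) : ℝ)⌋₊] (h (shift A x)) at h3
  simpa using h3

lemma continuous_of_natCast_eq {X : Type*} [TopologicalSpace X] {f : X → ℕ} {F : X → ℝ}
    (hF : Continuous F) (h : ∀ x, F x = f x) : Continuous f := by
  rw [Nat.isClosedEmbedding_coe_real.isEmbedding.continuous_iff]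
  exact hF.congr h

lemma exists_orbit_functions {T : SuspData A} (hT : IsSuspTriplet T) {h : Space A → Space B}
    {Φ : Susp T → StdSusp B}
    (hflow : ∀ (t : ℝ≥0) (p : Susp T), Φ (flow T t p) = flow (stdData B) t (Φ p))
    (hbase : ∀ x, Φ (basePoint T x) = stdBase B (h x)) :
    ∃ l k : C(Space A, ℕ), (∀ x, (shift B)^[l x] (h x) = (shift B)^[k x] (h (shift A x))) ∧
      PeriodicallyPositive A fun x => (l x : ℤ) - k x := by
  obtain ⟨-, -, ⟨c, hc, hcu⟩, hl, hk⟩ := hT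
  choose l hl using hl
  choose k hk using hk
  have hlc : Continuous l := continuous_of_natCast_eq (T.l.continuous.sub T.b.continuous) hl
  have hkc : Continuous k := continuous_of_natCast_eq
    (T.k.continuous.sub (T.b.continuous.comp (continuous_shift A))) hk
  refine ⟨⟨l, hlc⟩, ⟨k, hkc⟩, fun x => orbit_eq_of_flow_map hflow hbase (hl x) (hk x), ?_⟩
  obtain ⟨m, hm, hmc⟩ := PeriodicallyPositive.of_isOrderUnit hcu
  refine ⟨m, hm, fun x p hp hx => ?_⟩
  have key : birkhoffSum (shift A) (fun x => (l x : ℤ) - k x) p x = birkhoffSum (shift A) c p x := by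
    have h1 : ∀ y, (((l y : ℤ) - k y : ℤ) : ℝ) = c y - (T.b y - T.b (shift A y)) := fun y => by
      push_cast
      rw [← hl, ← hk, hc, cFun]
      ring
    have h2 : ∑ i ∈ Finset.range p,
        (T.b ((shift A)^[i] x) - T.b (shift A ((shift A)^[i] x))) = 0 := by
      simp_rw [← Function.iterate_succ_apply' (shift A)]
      rw [Finset.sum_range_sub' fun i => T.b ((shift A)^[i] x), hx]
      simp
    have h3 : ((birkhoffSum (shift A) (fun x => (l x : ℤ) - k x) p x : ℤ) : ℝ) =
        (birkhoffSum (shift A) c p x : ℤ) := by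
      rw [birkhoffSum, birkhoffSum, Int.cast_sum, Int.cast_sum,
        Finset.sum_congr rfl fun i _ => h1 ((shift A)^[i] x), Finset.sum_sub_distrib, h2, sub_zero]
    exact_mod_cast h3
  change (p : ℤ) ≤ m * birkhoffSum (shift A) (fun x => (l x : ℤ) - k x) p x
  rw [key]
  exact hmc x p hp hx

lemma isOrbitCocycle_of_periodicallyPositive {h : Space A → Space B} {l k : Space A → ℕ}
    (horb : ∀ x, (shift B)^[l x] (h x) = (shift B)^[k x] (h (shift A x)))
    (hpos : PeriodicallyPositive A fun x => (l x : ℤ) - k x) :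
    IsOrbitCocycle (shift A) (shift B) h l k := by
  refine ⟨horb, fun x n hn hx => ?_⟩
  obtain ⟨m, hm, hpos⟩ := hpos
  have h1 := hpos x n hn hx
  have h2 : birkhoffSum (shift A) (fun x => (l x : ℤ) - k x) n x =
      (birkhoffSum (shift A) l n x : ℕ) - (birkhoffSum (shift A) k n x : ℕ) := by
    simp [birkhoffSum, Finset.sum_sub_distrib]
  have h3 : 0 < birkhoffSum (shift A) (fun x => (l x : ℤ) - k x) n x := by
    by_contra! h4
    have := mul_nonpos_of_nonneg_of_nonpos (Int.natCast_nonneg m) h4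
    omega
  omega

end Suspension

section Zeta

variable {A : Matrix (Fin N) (Fin N) ℤ} {B : Matrix (Fin M) (Fin M) ℤ}

/-- The terms of the logarithm of the zeta function. -/
noncomputable def zetaTerm (A : Matrix (Fin N) (Fin N) ℤ) (f : Space A → ℤ) (s : ℂ)
    (p : PeriodicPair (shift A)) : ℂ :=
  (1 / (p.1 + 1 : ℂ)) * Complex.exp (-s * (birkhoffSum (shift A) f (p.1 + 1) p.2.1 : ℤ))

lemma zeta_eq_exp_tsum {f : Space A → ℤ} {s : ℂ} (hs : Summable (zetaTerm A f s)) :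
    zeta A f s = Complex.exp (∑' p, zetaTerm A f s p) := by
  rw [zeta, hs.tsum_sigma]
  congr 1
  refine tsum_congr fun n => ?_
  rw [← tsum_mul_left]
  rfl

lemma exists_summable_zetaTerm (hN : 0 < N) {f : Space A → ℤ} (hf : PeriodicallyPositive A f) :
    ∃ h0 : ℝ, ∀ s : ℂ, h0 < s.re → Summable (zetaTerm A f s) := by
  obtain ⟨m, hm, hf⟩ := hf
  have hm' : (0 : ℝ) < m := by exact_mod_cast hm
  have hN' : (0 : ℝ) < N := by exact_mod_cast hN
  refine ⟨m * Real.log N, fun s hs => ?_⟩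
  have hs0 : 0 ≤ s.re := (mul_nonneg hm'.le (Real.log_natCast_nonneg N)).trans hs.le
  set r := Real.exp (-(s.re / m)) with hr
  have hr0 : 0 < r := Real.exp_pos _
  have hNr : N * r < 1 := by
    have h1 : Real.log N < s.re / m := by rwa [lt_div_iff₀ hm', mul_comm]
    calc N * r = Real.exp (Real.log N + -(s.re / m)) := by rw [Real.exp_add, Real.exp_log hN']
      _ < 1 := Real.exp_lt_one_iff.2 (by linarith)
  have hfin : ∀ n, Finite {x : Space A // (shift A)^[n + 1] x = x} ∧
      Nat.card {x : Space A // (shift A)^[n + 1] x = x} ≤ N ^ (n + 1) := fun n => by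
    have h1 := finite_eventually_periodic A (Nat.succ_pos n)
    have e : {x : Space A // (shift A)^[0] x = (shift A)^[n.succ] x} ≃
        {x : Space A // (shift A)^[n + 1] x = x} := Equiv.subtypeEquivRight fun x => eq_comm
    have := h1.1
    exact ⟨Finite.of_equiv _ e, (Nat.card_congr e).symm.trans_le h1.2⟩
  have hsum : Summable fun p : PeriodicPair (shift A) => r ^ (p.1 + 1) := by
    rw [summable_sigma_of_nonneg fun p => pow_nonneg hr0.le _]
    refine ⟨fun n => ?_, ?_⟩
    · have := (hfin n).1
      exact Summable.of_finite
    · have hgeo : Summable fun n : ℕ => (N * r) ^ (n + 1) :=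
        (summable_nat_add_iff 1).2 (summable_geometric_of_lt_one (by positivity) hNr)
      refine hgeo.of_nonneg_of_le (fun n => tsum_nonneg fun _ => pow_nonneg hr0.le _) fun n => ?_
      change ∑' _ : {x : Space A // (shift A)^[n + 1] x = x}, r ^ (n + 1) ≤ _
      rw [tsum_const, nsmul_eq_mul, mul_pow]
      exact mul_le_mul_of_nonneg_right (by exact_mod_cast (hfin n).2) (pow_nonneg hr0.le _)
  refine hsum.of_norm_bounded fun p => ?_
  obtain ⟨n, x, hx⟩ := p
  have h1 : ((n + 1 : ℕ) : ℝ) ≤ m * (birkhoffSum (shift A) f (n + 1) x : ℤ) := by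
    exact_mod_cast hf x (n + 1) n.succ_pos hx
  have h2 : ‖(1 / (n + 1 : ℂ))‖ ≤ 1 := by
    have h3 : ‖(n + 1 : ℂ)‖ = n + 1 := by
      rw [← Nat.cast_succ, Complex.norm_natCast]
      push_cast
      rfl
    rw [norm_div, norm_one, h3]
    exact div_le_one_of_le₀ (by linarith [Nat.cast_nonneg (α := ℝ) n]) (by positivity)
  have h3 : (-s * (birkhoffSum (shift A) f (n + 1) x : ℤ)).re =
      -(s.re * (birkhoffSum (shift A) f (n + 1) x : ℤ)) := by simp
  rw [zetaTerm, norm_mul, Complex.norm_exp, h3]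
  refine (mul_le_of_le_one_left (Real.exp_pos _).le h2).trans ?_
  rw [hr, ← Real.exp_nat_mul, Real.exp_le_exp]
  have h4 : ((n + 1 : ℕ) : ℝ) / m ≤ (birkhoffSum (shift A) f (n + 1) x : ℤ) := by
    rwa [div_le_iff₀ hm', mul_comm]
  have h5 := mul_le_mul_of_nonneg_left h4 hs0
  have h6 : ((n + 1 : ℕ) : ℝ) * -(s.re / m) = -(s.re * (((n + 1 : ℕ) : ℝ) / m)) := by ring
  change _ ≤ ((n + 1 : ℕ) : ℝ) * -(s.re / m)
  rw [h6]
  linarith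

lemma PeriodicallyPositive.pullback {h : Space A → Space B} {l k : Space A → ℕ}
    (H : IsOrbitCocycle (shift A) (shift B) h l k)
    (hpos : PeriodicallyPositive A fun x => (l x : ℤ) - k x) {f : Space B → ℤ}
    (hf : PeriodicallyPositive B f) :
    PeriodicallyPositive A (pullback (shift A) (shift B) h l k f) := by
  obtain ⟨m, hm, hpos⟩ := hpos
  obtain ⟨m', hm', hf⟩ := hf
  refine ⟨m * m', Nat.mul_pos hm hm', fun x p hp hx => ?_⟩
  obtain ⟨y, -, hy, hyf⟩ := H.exists_periodic hp hx
  have h1 := hf y _ (H.imageLength_pos hp hx) hy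
  have h2 := hpos x p hp hx
  rw [← H.cast_imageLength hp hx] at h2
  rw [hyf]
  push_cast
  rw [mul_assoc]
  exact h2.trans (mul_le_mul_of_nonneg_left h1 (Int.natCast_nonneg m))

lemma zetaSet_subset_of_flowEquivVia (hN : 0 < N) (hM : 0 < M) (hA01 : IsZeroOne A)
    (hB01 : IsZeroOne B) (hAirr : IsIrreducible A) (hBirr : IsIrreducible B)
    (hAnp : ¬ IsPermutationMatrix A) (hBnp : ¬ IsPermutationMatrix B) {h : Space A ≃ₜ Space B}
    (hfe : FlowEquivVia A B h) : ZetaSet B ⊆ ZetaSet A := by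
  obtain ⟨T₁, hT₁, T₂, hT₂, Φ₁, -, Φ₂, -, hf₁, hb₁, hf₂, hb₂⟩ := hfe
  obtain ⟨l, k, horb, hpos⟩ := exists_orbit_functions hT₁ hf₁ hb₁
  obtain ⟨l', k', horb', hpos'⟩ := exists_orbit_functions hT₂ hf₂ hb₂
  have H := isOrbitCocycle_of_periodicallyPositive horb hpos
  have H' := isOrbitCocycle_of_periodicallyPositive horb' hpos'
  have hone := pullback_sub_eq_one hA01 hAirr hAnp h horb horb'
  have hone' := pullback_sub_eq_one hB01 hBirr hBnp h.symm horb' horb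
  rintro F ⟨g, hg, h0, hF⟩
  have hgp := PeriodicallyPositive.of_isOrderUnit hg
  have hgp' := PeriodicallyPositive.pullback H hpos hgp
  obtain ⟨h1, hs1⟩ := exists_summable_zetaTerm hM hgp
  obtain ⟨h2, hs2⟩ := exists_summable_zetaTerm hN hgp'
  refine ⟨⟨_, continuous_pullback (continuous_shift A) (continuous_shift B) g.continuous
    l.continuous k.continuous h.continuous⟩, PeriodicallyPositive.isOrderUnit hA01 hAirr hgp',
    max h0 (max h1 h2), fun s hs => ?_⟩
  simp only [max_lt_iff] at hs
  obtain ⟨hs0, hs1', hs2'⟩ := hs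
  rw [hF s hs0, zeta_eq_exp_tsum (hs1 s hs1')]
  refine Eq.trans ?_ (zeta_eq_exp_tsum (hs2 s hs2')).symm
  congr 1
  exact (tsum_periodicPair_pullback H H' h.symm_apply_apply h.apply_symm_apply hone hone' g
    (fun v => Complex.exp (-s * v)) (hs2 s hs2') (hs1 s hs1')).symm

lemma FlowEquivVia.symm {h : Space A ≃ₜ Space B} (hfe : FlowEquivVia A B h) :
    FlowEquivVia B A h.symm := by
  obtain ⟨T₁, hT₁, T₂, hT₂, Φ₁, hc₁, Φ₂, hc₂, hf₁, hb₁, hf₂, hb₂⟩ := hfe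
  exact ⟨T₂, hT₂, T₁, hT₁, Φ₂, hc₂, Φ₁, hc₁, hf₂, hb₂, hf₁, hb₁⟩

end Zeta

theorem zetaSet_invariant_of_oneSidedFlowEquiv
    {N M : ℕ} (A : Matrix (Fin N) (Fin N) ℤ) (B : Matrix (Fin M) (Fin M) ℤ)
    (hN : 1 < N) (hM : 1 < M) (hA01 : IsZeroOne A) (hB01 : IsZeroOne B)
    (hAirr : IsIrreducible A) (hBirr : IsIrreducible B)
    (hAnp : ¬ IsPermutationMatrix A) (hBnp : ¬ IsPermutationMatrix B)
    (hfe : OneSidedFlowEquiv A B) :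
    ZetaSet A = ZetaSet B := by
  obtain ⟨h, hfe⟩ := hfe
  have hN0 : 0 < N := by omega
  have hM0 : 0 < M := by omega
  exact Set.Subset.antisymm
    (zetaSet_subset_of_flowEquivVia hM0 hN0 hB01 hA01 hBirr hAirr hBnp hAnp hfe.symm)
    (zetaSet_subset_of_flowEquivVia hN0 hM0 hA01 hB01 hAirr hBirr hAnp hBnp hfe)

end OneSidedMarkov
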